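/- For every positive integer n, a_n^6 ≥ 8π³ · exp(1/(2n) - 1/(60n³)). -/

import Mathlib

open Real

noncomputable def ramanujanA (n : ℕ) : ℝ :=
  (Nat.factorial n : ℝ) / (Real.sqrt n * ((n : ℝ) / Real.exp 1) ^ n)

/-- Two terms of the Stirling series for `log n!`. -/
noncomputable def stirlingCorrection (x : ℝ) : ℝ := 1 / (12 * x) - 1 / (360 * x ^ 3)

lemma stirlingCorrection_sub_le {x : ℝ} (hx : 0 < x) :
    stirlingCorrection x - stirlingCorrection (x + 1) ≤
      1 / 3 * (1 / (2 * x + 1)) ^ 2 + 1 / 5 * ((1 / (2 * x + 1)) ^ 2) ^ 2 := by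
  rw [← sub_nonneg]
  have key : 1 / 3 * (1 / (2 * x + 1)) ^ 2 + 1 / 5 * ((1 / (2 * x + 1)) ^ 2) ^ 2 -
      (stirlingCorrection x - stirlingCorrection (x + 1)) =
      (10 * (x * (x + 1)) ^ 2 + 11 * (x * (x + 1)) + 1) /
        (360 * (x * (x + 1)) ^ 3 * (2 * x + 1) ^ 4) := by
    unfold stirlingCorrection
    field_simp
    ring
  rw [key]
  positivity

lemma stirlingCorrection_sub_le_log_stirlingSeq_sub (m : ℕ) :
    stirlingCorrection (m + 1) - stirlingCorrection (m + 1 + 1) ≤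
      log (Stirling.stirlingSeq (m + 1)) - log (Stirling.stirlingSeq (m + 2)) := by
  refine (stirlingCorrection_sub_le (by positivity)).trans ?_
  have h := sum_le_hasSum (Finset.range 2) (fun k _ => by positivity)
    (Stirling.log_stirlingSeq_sdiff_hasSum m)
  refine le_trans (le_of_eq ?_) h
  simp only [Finset.sum_range_succ, Finset.sum_range_zero]
  push_cast
  norm_num

lemma tendsto_stirlingCorrection :
    Filter.Tendsto (fun m : ℕ => stirlingCorrection (m + 1)) Filter.atTop (nhds 0) := by
  have h : Filter.Tendsto (fun m : ℕ => 1 / ((m : ℝ) + 1)) Filter.atTop (nhds 0) :=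
    tendsto_one_div_add_atTop_nhds_zero_nat
  have h' := (h.const_mul (1 / 12)).sub ((h.pow 3).const_mul (1 / 360))
  norm_num at h'
  refine h'.congr fun m => ?_
  unfold stirlingCorrection
  field_simp

lemma log_sqrt_pi_add_stirlingCorrection_le (m : ℕ) :
    log √π + stirlingCorrection (m + 1) ≤ log (Stirling.stirlingSeq (m + 1)) := by
  have anti : Antitone fun m : ℕ =>
      log (Stirling.stirlingSeq (m + 1)) - stirlingCorrection (m + 1) := by
    refine antitone_nat_of_succ_le fun k => ?_
    have h := stirlingCorrection_sub_le_log_stirlingSeq_sub k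
    push_cast
    linarith
  have lim := ((Stirling.tendsto_stirlingSeq_sqrt_pi.comp
    (Filter.tendsto_add_atTop_nat 1)).log (by positivity)).sub tendsto_stirlingCorrection
  rw [sub_zero] at lim
  have h := anti.le_of_tendsto lim m
  linarith

lemma ramanujanA_eq_sqrt_two_mul_stirlingSeq (n : ℕ) :
    ramanujanA n = √2 * Stirling.stirlingSeq n := by
  rw [ramanujanA, Stirling.stirlingSeq, Real.sqrt_mul zero_le_two, mul_assoc,
    mul_div_assoc', mul_div_mul_left _ _ (by positivity)]

theorem ramanujanA_pow_six_ge (n : ℕ) (hn : 0 < n) :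
    ramanujanA n ^ 6 ≥ 8 * π ^ 3 *
      Real.exp (1 / (2 * (n : ℝ)) - 1 / (60 * (n : ℝ) ^ 3)) := by
  obtain ⟨m, rfl⟩ := Nat.exists_eq_add_of_lt hn
  rw [zero_add]
  have h := log_sqrt_pi_add_stirlingCorrection_le m
  have hpi : 0 < √π := by positivity
  rw [Real.le_log_iff_exp_le (Stirling.stirlingSeq'_pos m), Real.exp_add,
    Real.exp_log hpi] at h
  have h6 : (√π * exp (stirlingCorrection (m + 1))) ^ 6 ≤
      Stirling.stirlingSeq (m + 1) ^ 6 := by gcongr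
  have hexp : exp (1 / (2 * ((m + 1 : ℕ) : ℝ)) - 1 / (60 * ((m + 1 : ℕ) : ℝ) ^ 3)) =
      exp (stirlingCorrection (m + 1)) ^ 6 := by
    rw [← Real.exp_nat_mul]
    congr 1
    unfold stirlingCorrection
    push_cast
    field_simp
    ring
  have h2 : √2 ^ 6 = (8 : ℝ) := by
    rw [show √2 ^ 6 = (√2 ^ 2) ^ 3 by ring, Real.sq_sqrt zero_le_two]
    norm_num
  have hpi6 : √π ^ 6 = π ^ 3 := by
    rw [show √π ^ 6 = (√π ^ 2) ^ 3 by ring, Real.sq_sqrt pi_pos.le]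
  rw [mul_pow, hpi6] at h6
  rw [ramanujanA_eq_sqrt_two_mul_stirlingSeq, mul_pow, h2, hexp, mul_assoc]
  gcongr
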